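/- arXiv:1305.4749 — 5 statements merged into one kernel-verified Lean document; each statement's English description precedes it below -/
import Mathlib

section
/- Let Γ = (V, E) be a finite directed graph without parallel edges (i.e., E is a set of ordered pairs of vertices). Define T(Γ) = E ∘ E^op ∪ E^op ∘ E, i.e., T(Γ) is the set of ordered pairs (v_i, v_j) of vertices that are mutually neighbored, meaning there exists a vertex w with (w, v_i) ∈ E and (w, v_j) ∈ E, or there exists a vertex w with (v_i, w) ∈ E and (v_j, w) ∈ E. Then |T(Γ)| ≥ |E|. -/
open Classical in
/-- The ratios of out-degree to in-degree along the edges of a finite relation sum to at most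
the number of pairs admitting a common in-neighbor. -/
theorem sum_degree_div_degree_le_card_common_neighbor {V : Type*} [Fintype V] (r : V → V → Prop) :
    ∑ u, ∑ v, (if r u v then
        ((Finset.univ.filter (r u)).card : ℚ) / (Finset.univ.filter (r · v)).card else 0) ≤
      (Finset.univ.filter fun p : V × V => ∃ w, r w p.1 ∧ r w p.2).card := by
  have hcard : (Finset.univ.filter fun p : V × V => ∃ w, r w p.1 ∧ r w p.2).card =
      ∑ v, (Finset.univ.filter fun v' => ∃ w, r w v ∧ r w v').card := by
    simp only [Finset.card_filter, Fintype.sum_prod_type]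
  rw [hcard, Finset.sum_comm, Nat.cast_sum]
  refine Finset.sum_le_sum fun v _ => ?_
  rw [← Finset.sum_filter, ← Finset.sum_div]
  refine div_le_of_le_mul₀ (Nat.cast_nonneg _) (Nat.cast_nonneg _) ?_
  rw [mul_comm, ← nsmul_eq_mul]
  refine Finset.sum_le_card_nsmul _ _ _ fun u hu => ?_
  have huv : r u v := (Finset.mem_filter.mp hu).2
  exact_mod_cast Finset.card_le_card fun v' hv' => by
    simp only [Finset.mem_filter, Finset.mem_univ, true_and] at hv' ⊢
    exact ⟨u, huv, hv'⟩

/-- **Theorem A.** For any finite digraph `Γ = (V, E)` without parallel edges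
(`E` a set of ordered pairs of vertices), the set `T(Γ)` of mutually neighbored
ordered pairs (pairs admitting a common in-neighbor or a common out-neighbor)
satisfies `|T(Γ)| ≥ |E|`. -/
theorem digraph_card_mutually_neighbored_ge_card_edges
    {V : Type*} [Fintype V] (E : Set (V × V)) :
    E.ncard ≤
      {p : V × V | (∃ w : V, (w, p.1) ∈ E ∧ (w, p.2) ∈ E) ∨
        (∃ w : V, (p.1, w) ∈ E ∧ (p.2, w) ∈ E)}.ncard := by
  classical
  rw [Set.ncard_eq_toFinset_card', Set.ncard_eq_toFinset_card', Set.toFinset_ofPred]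
  have hin := sum_degree_div_degree_le_card_common_neighbor fun u v => (u, v) ∈ E
  have hout := sum_degree_div_degree_le_card_common_neighbor fun u v => (v, u) ∈ E
  rw [Finset.sum_comm] at hout
  have hedges : (2 : ℚ) * E.toFinset.card = ∑ u, ∑ v, if (u, v) ∈ E then (2 : ℚ) else 0 := by
    rw [← Fintype.sum_prod_type' (f := fun u v => if (u, v) ∈ E then (2 : ℚ) else 0),
      ← Finset.sum_filter, Finset.sum_const, nsmul_eq_mul, mul_comm]
    congr 3
    ext; simp
  have hsum : (2 : ℚ) * E.toFinset.card ≤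
      (Finset.univ.filter fun p : V × V => ∃ w, (w, p.1) ∈ E ∧ (w, p.2) ∈ E).card +
      (Finset.univ.filter fun p : V × V => ∃ w, (p.1, w) ∈ E ∧ (p.2, w) ∈ E).card := by
    refine le_trans ?_ (add_le_add hin hout)
    rw [hedges, ← Finset.sum_add_distrib]
    refine Finset.sum_le_sum fun u _ => ?_
    rw [← Finset.sum_add_distrib]
    refine Finset.sum_le_sum fun v _ => ?_
    split_ifs with h
    · have hu : (0 : ℚ) < (Finset.univ.filter fun v' => (u, v') ∈ E).card :=
        Nat.cast_pos.mpr (Finset.card_pos.mpr ⟨v, by simpa using h⟩)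
      have hv : (0 : ℚ) < (Finset.univ.filter fun u' => (u', v) ∈ E).card :=
        Nat.cast_pos.mpr (Finset.card_pos.mpr ⟨u, by simpa using h⟩)
      rw [div_add_div _ _ hv.ne' hu.ne', le_div_iff₀ (mul_pos hv hu)]
      nlinarith [sq_nonneg (((Finset.univ.filter fun v' => (u, v') ∈ E).card : ℚ) -
        (Finset.univ.filter fun u' => (u', v) ∈ E).card)]
    · simp
  have hsum_nat : 2 * E.toFinset.card ≤
      (Finset.univ.filter fun p : V × V => ∃ w, (w, p.1) ∈ E ∧ (w, p.2) ∈ E).card +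
      (Finset.univ.filter fun p : V × V => ∃ w, (p.1, w) ∈ E ∧ (p.2, w) ∈ E).card := by
    exact_mod_cast hsum
  rw [Finset.filter_or]
  have hleft := Finset.card_le_card (Finset.subset_union_left
    (s₁ := Finset.univ.filter fun p : V × V => ∃ w, (w, p.1) ∈ E ∧ (w, p.2) ∈ E)
    (s₂ := Finset.univ.filter fun p : V × V => ∃ w, (p.1, w) ∈ E ∧ (p.2, w) ∈ E))
  have hright := Finset.card_le_card (Finset.subset_union_right
    (s₁ := Finset.univ.filter fun p : V × V => ∃ w, (w, p.1) ∈ E ∧ (w, p.2) ∈ E)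
    (s₂ := Finset.univ.filter fun p : V × V => ∃ w, (p.1, w) ∈ E ∧ (p.2, w) ∈ E))
  lia
end

section
/- Let Γ be a finite undirected graph without parallel edges on vertex set V. Let γ₁ be the set of ordered pairs (i, j) such that there is a path of length 1 between v_i and v_j (i.e., {v_i, v_j} is an edge), and let γ₂ be the set of ordered pairs (i, j) such that there is a path of length 2 between v_i and v_j (i.e., there exists a vertex w adjacent to both v_i and v_j). Then |γ₂| ≥ |γ₁|. -/
/-- The number of pairs satisfying a relation is the sum of the sizes of its fibres. -/
lemma ncard_setOf_prod_eq_sum {V : Type*} [Fintype V] (R : V → V → Prop)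
    [∀ v, DecidablePred (R v)] :
    {p : V × V | R p.1 p.2}.ncard = ∑ v, (Finset.univ.filter (R v)).card := by
  classical
  have h : {p : V × V | R p.1 p.2} =
      ((Finset.univ.filter fun p : V × V => R p.1 p.2 : Finset (V × V)) : Set (V × V)) := by
    ext p
    simp
  rw [h, Set.ncard_coe_finset]
  simp only [Finset.card_filter]
  exact Fintype.sum_prod_type _

lemma two_le_div_add_div {a b : ℚ} (ha : 0 < a) (hb : 0 < b) : 2 ≤ a / b + b / a := by
  rw [div_add_div _ _ hb.ne' ha.ne', le_div_iff₀ (mul_pos hb ha)]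
  nlinarith [sq_nonneg (a - b)]

/-- For a finite undirected graph without parallel edges (a symmetric adjacency
relation `Adj` on a finite vertex set `V`), the number of ordered pairs of
vertices joined by a path of length 2 is at least the number of ordered pairs
joined by a path of length 1 (i.e. adjacent pairs): `|γ₂| ≥ |γ₁|`. -/
theorem undirected_card_paths_length_two_ge_card_edges
    {V : Type*} [Fintype V] (Adj : V → V → Prop) (hsymm : Symmetric Adj) :
    {p : V × V | Adj p.1 p.2}.ncard ≤
      {p : V × V | ∃ w : V, Adj p.1 w ∧ Adj w p.2}.ncard := by
  classical
  rw [ncard_setOf_prod_eq_sum Adj, ncard_setOf_prod_eq_sum fun u v => ∃ w, Adj u w ∧ Adj w v]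
  set d : V → ℕ := fun v => (Finset.univ.filter (Adj v)).card
  set D : V → ℕ := fun v => (Finset.univ.filter fun x => ∃ w, Adj v w ∧ Adj w x).card
  have hpos {v w : V} (h : Adj v w) : (0 : ℚ) < d v :=
    Nat.cast_pos.2 (Finset.card_pos.2 ⟨w, by simpa using h⟩)
  have hle {v w : V} (h : Adj v w) : d w ≤ D v :=
    Finset.card_le_card fun x hx => by
      simp only [Finset.mem_filter, Finset.mem_univ, true_and] at hx ⊢
      exact ⟨w, h, hx⟩
  let f : V → V → ℚ := fun v w => if Adj v w then (d w : ℚ) / d v else 0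
  -- `D v` dominates the average degree of the neighbours of `v`.
  have havg (v : V) : ∑ w, f v w ≤ D v := by
    simp only [f]
    rw [← Finset.sum_filter, ← Finset.sum_div]
    refine div_le_of_le_mul₀ (Nat.cast_nonneg _) (Nat.cast_nonneg _) ?_
    have h := Finset.sum_le_card_nsmul (Finset.univ.filter (Adj v)) (fun w => (d w : ℚ)) (D v)
      fun w hw => Nat.cast_le.2 (hle (by simpa using hw))
    rwa [nsmul_eq_mul, mul_comm] at h
  have hpair (v w : V) : (if Adj v w then (2 : ℚ) else 0) ≤ f v w + f w v := by
    by_cases h : Adj v w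
    · simpa [f, h, hsymm h] using two_le_div_add_div (hpos (hsymm h)) (hpos h)
    · have h' : ¬ Adj w v := fun h' => h (hsymm h')
      simp [f, h, h']
  have hsum : ∑ v, ∑ w, (if Adj v w then (2 : ℚ) else 0) ≤ ∑ v, ∑ w, (f v w + f w v) :=
    Finset.sum_le_sum fun v _ => Finset.sum_le_sum fun w _ => hpair v w
  have hleft : ∑ v, ∑ w, (if Adj v w then (2 : ℚ) else 0) = 2 * ∑ v, (d v : ℚ) := by
    rw [Finset.mul_sum]
    refine Finset.sum_congr rfl fun v _ => ?_
    rw [← Finset.sum_filter, Finset.sum_const, nsmul_eq_mul, mul_comm]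
  have hright : ∑ v, ∑ w, (f v w + f w v) = 2 * ∑ v, ∑ w, f v w := by
    simp only [Finset.sum_add_distrib]
    rw [Finset.sum_comm (f := fun v w => f w v), two_mul]
  have hD_sum : ∑ v, ∑ w, f v w ≤ ∑ v, (D v : ℚ) := Finset.sum_le_sum fun v _ => havg v
  have hfinal : ∑ v, (d v : ℚ) ≤ ∑ v, (D v : ℚ) := by linarith
  exact_mod_cast hfinal
end

section
/- For any n × n matrix A with entries in the nonnegative real numbers, |Supp(A·Aᵀ + Aᵀ·A)| ≥ |Supp(A)|, where Supp(B) denotes the set of positions (i, j) at which the matrix B has a nonzero entry and Aᵀ is the transpose of A. -/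
section RelationCounting

open Finset

open Classical in
/-- The related pairs `(a, b)` for which the degree of `a` is at most the degree of `b` are no more
numerous than the pairs of elements of `α` with a common neighbour in `β`. -/
theorem card_filter_degree_le_card_common_neighbor {α β : Type*} [Fintype α] [Fintype β]
    (R : α → β → Prop) :
    #{p : α × β | R p.1 p.2 ∧ #{b | R p.1 b} ≤ #{a | R a p.2}} ≤
      #{p : α × α | ∃ b, R p.1 b ∧ R p.2 b} := by
  rw [card_filter, card_filter, Fintype.sum_prod_type, Fintype.sum_prod_type]
  refine sum_le_sum fun x _ => ?_
  rw [← card_filter, ← card_filter]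
  dsimp only
  rcases eq_empty_or_nonempty {y : β | R x y ∧ #{b | R x b} ≤ #{a | R a y}} with h | ⟨y, hy⟩
  · simp [h]
  · simp only [mem_filter, mem_univ, true_and] at hy
    calc _ ≤ #{b | R x b} := card_le_card fun z => by simp +contextual
      _ ≤ #{a | R a y} := hy.2
      _ ≤ _ := card_le_card fun z hz => by
        simp only [mem_filter, mem_univ, true_and] at hz ⊢
        exact ⟨y, hy.1, hz⟩

/-- Two elements are linked by `R` when they have a common out-neighbour or a common
in-neighbour. -/
def HasCommonNeighbor {α : Type*} (R : α → α → Prop) (p : α × α) : Prop :=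
  (∃ b, R p.1 b ∧ R p.2 b) ∨ ∃ b, R b p.1 ∧ R b p.2

theorem card_rel_le_two_mul_card_hasCommonNeighbor {α : Type*} [Fintype α]
    (R : α → α → Prop) :
    Nat.card {p : α × α // R p.1 p.2} ≤ 2 * Nat.card {p : α × α // HasCommonNeighbor R p} := by
  classical
  have key := card_filter_degree_le_card_common_neighbor R
  have key' := card_filter_degree_le_card_common_neighbor (flip R)
  have hflip : #{p : α × α | R p.1 p.2 ∧ #{a | R a p.2} ≤ #{b | R p.1 b}} ≤
      #{p : α × α | flip R p.1 p.2 ∧ #{b | flip R p.1 b} ≤ #{a | flip R a p.2}} :=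
    card_le_card_of_injOn Prod.swap (fun p hp => by
      simp only [coe_filter, Set.mem_ofPred_eq, mem_univ, true_and] at hp ⊢
      exact hp)
      Prod.swap_injective.injOn
  have hcover : #{p : α × α | R p.1 p.2} ≤
      #{p : α × α | R p.1 p.2 ∧ #{b | R p.1 b} ≤ #{a | R a p.2}} +
      #{p : α × α | R p.1 p.2 ∧ #{a | R a p.2} ≤ #{b | R p.1 b}} := by
    refine (card_le_card fun p hp => ?_).trans (card_union_le _ _)
    simp only [mem_filter, mem_univ, true_and, mem_union] at hp ⊢
    exact (le_total _ _).imp (⟨hp, ·⟩) (⟨hp, ·⟩)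
  have hout : #{p : α × α | ∃ b, R p.1 b ∧ R p.2 b} ≤ #{p : α × α | HasCommonNeighbor R p} :=
    card_le_card (monotone_filter_right _ fun _ _ => Or.inl)
  have hin : #{p : α × α | ∃ b, flip R p.1 b ∧ flip R p.2 b} ≤
      #{p : α × α | HasCommonNeighbor R p} :=
    card_le_card (monotone_filter_right _ fun _ _ => Or.inr)
  rw [Nat.card_eq_fintype_card, Nat.card_eq_fintype_card, Fintype.card_subtype,
    Fintype.card_subtype]
  omega

/-- Pairs of tuples satisfying a predicate coordinatewise are tuples of pairs satisfying it. -/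
theorem card_pi_prod_forall {α : Type*} (k : ℕ) (T : α × α → Prop) :
    Nat.card {p : (Fin k → α) × (Fin k → α) // ∀ i, T (p.1 i, p.2 i)} =
      Nat.card {p : α × α // T p} ^ k := by
  have e : {p : (Fin k → α) × (Fin k → α) // ∀ i, T (p.1 i, p.2 i)} ≃
      (Fin k → {p : α × α // T p}) :=
    { toFun := fun p i => ⟨(p.1.1 i, p.1.2 i), p.2 i⟩
      invFun := fun f => ⟨(fun i => (f i).1.1, fun i => (f i).1.2), fun i => (f i).2⟩
      left_inv := fun _ => rfl
      right_inv := fun _ => rfl }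
  rw [Nat.card_congr e, Nat.card_fun, Nat.card_fin]

theorem Nat.le_of_forall_pow_le_mul_pow {a b c : ℕ} (h : ∀ k, a ^ k ≤ c * b ^ k) : a ≤ b := by
  by_contra! hlt
  rcases Nat.eq_zero_or_pos b with rfl | hb
  · have := h 1
    simp at this
    omega
  · have hb' : (0 : ℝ) < b := by exact_mod_cast hb
    have hone : (1 : ℝ) < a / b := by
      rw [one_lt_div hb']
      exact_mod_cast hlt
    obtain ⟨k, hk⟩ := pow_unbounded_of_one_lt (c : ℝ) hone
    rw [div_pow, lt_div_iff₀ (by positivity)] at hk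
    exact (h k).not_gt (by exact_mod_cast hk)

/-- The constant `2` is removed by passing to tensor powers of the relation. -/
theorem card_rel_le_card_hasCommonNeighbor {α : Type*} [Fintype α] (R : α → α → Prop) :
    Nat.card {p : α × α // R p.1 p.2} ≤ Nat.card {p : α × α // HasCommonNeighbor R p} := by
  refine Nat.le_of_forall_pow_le_mul_pow (c := 2) fun k => ?_
  rw [← card_pi_prod_forall k (fun p => R p.1 p.2), ← card_pi_prod_forall k (HasCommonNeighbor R)]
  refine (card_rel_le_two_mul_card_hasCommonNeighbor
    fun f g : Fin k → α => ∀ i, R (f i) (g i)).trans (Nat.mul_le_mul_left 2 ?_)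
  refine Nat.card_mono (Set.toFinite _) ?_
  rintro p (⟨b, h₁, h₂⟩ | ⟨b, h₁, h₂⟩) i
  · exact Or.inl ⟨b i, h₁ i, h₂ i⟩
  · exact Or.inr ⟨b i, h₁ i, h₂ i⟩

end RelationCounting

open Matrix in
/-- For any `n × n` matrix `A` with nonnegative real entries,
`|Supp(A·Aᵀ + Aᵀ·A)| ≥ |Supp(A)|`, where `Supp(B)` is the set of positions at
which `B` has a nonzero entry. -/
theorem card_support_mul_transpose_add_transpose_mul_ge
    {n : ℕ} (A : Matrix (Fin n) (Fin n) ℝ) (hA : ∀ i j, 0 ≤ A i j) :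
    {p : Fin n × Fin n | A p.1 p.2 ≠ 0}.ncard ≤
      {p : Fin n × Fin n | (A * Aᵀ + Aᵀ * A) p.1 p.2 ≠ 0}.ncard := by
  refine (card_rel_le_card_hasCommonNeighbor fun i j => A i j ≠ 0).trans
    (Nat.card_mono (Set.toFinite _) ?_)
  rintro ⟨i, j⟩ hij
  have hout : ∀ k ∈ Finset.univ, 0 ≤ A i k * A j k := fun k _ => mul_nonneg (hA i k) (hA j k)
  have hin : ∀ k ∈ Finset.univ, 0 ≤ A k i * A k j := fun k _ => mul_nonneg (hA k i) (hA k j)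
  simp only [Set.mem_ofPred_eq, Matrix.add_apply, Matrix.mul_apply, Matrix.transpose_apply]
  rw [Ne, add_eq_zero_iff_of_nonneg (Finset.sum_nonneg hout) (Finset.sum_nonneg hin),
    Finset.sum_eq_zero_iff_of_nonneg hout, Finset.sum_eq_zero_iff_of_nonneg hin]
  rintro ⟨h₁, h₂⟩
  rcases hij with ⟨k, hi, hj⟩ | ⟨k, hi, hj⟩
  · exact mul_ne_zero hi hj (h₁ k (Finset.mem_univ k))
  · exact mul_ne_zero hi hj (h₂ k (Finset.mem_univ k))
end

section
/- Let Γ = (V, E) be a finite directed graph without parallel edges and without loops, having at least one edge, which is not Eulerian in the sense that some vertex v satisfies |D^-(v)| ≠ |D^+(v)|. Then there exists an edge (v_j, v_i) ∈ E such that |D^-(v_i)| > |D^+(v_i)| and |D^-(v_j)| ≤ |D^+(v_j)|. -/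
/-- In a finite digraph, the in-degrees and the out-degrees have the same sum. -/
theorem sum_indeg_eq_sum_outdeg {V : Type*} [Fintype V] [DecidableEq V] (E : Finset (V × V)) :
    ∑ v, (Finset.univ.filter fun w => (w, v) ∈ E).card =
      ∑ v, (Finset.univ.filter fun w => (v, w) ∈ E).card := by
  simp only [Finset.card_filter]
  exact Finset.sum_comm

/-- If no edge enters `S` from outside, the in-degrees over `S` sum to at most the out-degrees. -/
theorem sum_indeg_le_sum_outdeg_of_closed {V : Type*} [Fintype V] [DecidableEq V]
    (E : Finset (V × V)) (S : Finset V) (hS : ∀ v ∈ S, ∀ w, (w, v) ∈ E → w ∈ S) :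
    ∑ v ∈ S, (Finset.univ.filter fun w => (w, v) ∈ E).card ≤
      ∑ v ∈ S, (Finset.univ.filter fun w => (v, w) ∈ E).card := by
  simp only [Finset.card_filter]
  calc ∑ v ∈ S, ∑ w, (if (w, v) ∈ E then 1 else 0)
      = ∑ v ∈ S, ∑ w ∈ S, (if (w, v) ∈ E then 1 else 0) := by
        refine Finset.sum_congr rfl fun v hv => ?_
        refine (Finset.sum_subset (Finset.subset_univ S) fun w _ hw => ?_).symm
        exact if_neg fun h => hw (hS v hv w h)
    _ = ∑ w ∈ S, ∑ v ∈ S, (if (w, v) ∈ E then 1 else 0) := Finset.sum_comm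
    _ ≤ ∑ w ∈ S, ∑ v, (if (w, v) ∈ E then 1 else 0) :=
        Finset.sum_le_sum fun w _ =>
          Finset.sum_le_sum_of_subset (Finset.subset_univ S)


/-- Let `Γ = (V, E)` be a finite loopless digraph without parallel edges having
at least one edge, which is not Eulerian: some vertex has in-degree different
from its out-degree.  Then there is an edge `(v_j, v_i) ∈ E` with
`|D⁻(v_i)| > |D⁺(v_i)|` and `|D⁻(v_j)| ≤ |D⁺(v_j)|`. -/
theorem exists_edge_from_balanced_to_indeg_gt_outdeg
    {V : Type*} [Fintype V] [DecidableEq V] (E : Finset (V × V))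
    (hloopless : ∀ v : V, (v, v) ∉ E)
    (hnonempty : E.Nonempty)
    (hnonEulerian : ∃ v : V,
      (Finset.univ.filter fun w => (w, v) ∈ E).card ≠
        (Finset.univ.filter fun w => (v, w) ∈ E).card) :
    ∃ i j : V, (j, i) ∈ E ∧
      (Finset.univ.filter fun w => (w, i) ∈ E).card >
        (Finset.univ.filter fun w => (i, w) ∈ E).card ∧
      (Finset.univ.filter fun w => (w, j) ∈ E).card ≤
        (Finset.univ.filter fun w => (j, w) ∈ E).card := by
  by_contra! hno
  let S : Finset V := Finset.univ.filter fun v =>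
    (Finset.univ.filter fun w => (v, w) ∈ E).card <
      (Finset.univ.filter fun w => (w, v) ∈ E).card
  have hmem : ∀ v, v ∈ S ↔ (Finset.univ.filter fun w => (v, w) ∈ E).card <
      (Finset.univ.filter fun w => (w, v) ∈ E).card := fun v => by simp [S]
  have hne : S.Nonempty := by
    by_contra hempty
    rw [Finset.not_nonempty_iff_eq_empty] at hempty
    have hle : ∀ v ∈ Finset.univ, (Finset.univ.filter fun w => (w, v) ∈ E).card ≤
        (Finset.univ.filter fun w => (v, w) ∈ E).card := fun v _ =>
      not_lt.mp fun h => by simpa [hempty] using (hmem v).mpr h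
    obtain ⟨v, hv⟩ := hnonEulerian
    exact hv ((Finset.sum_eq_sum_iff_of_le hle).mp (sum_indeg_eq_sum_outdeg E) v
      (Finset.mem_univ v))
  have hlt := Finset.sum_lt_sum_of_nonempty hne fun v hv => (hmem v).mp hv
  exact hlt.not_ge <| sum_indeg_le_sum_outdeg_of_closed E S fun v hv w hwv =>
    (hmem w).mpr (hno v w hwv ((hmem v).mp hv))
end

section
/- Let G be a group with identity e, let H ≤ G be a subgroup, let n ≥ 1, and let (g_1, …, g_n) ∈ G^n. For each g ∈ G let E_g = {(i, j) ∈ {1, …, n}² : ∃ h ∈ H, g_i⁻¹ h g_j = g}. Then for every g ∈ G, |E_e| ≥ |E_g|. -/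
open Finset in
theorem Finset.card_filter_eq_eq_sum_card_mul_card {ι κ X : Type*} [Fintype ι] [Fintype κ]
    [DecidableEq X] (a : ι → X) (b : κ → X) {s : Finset X} (hs : ∀ i, a i ∈ s) :
    #{p : ι × κ | a p.1 = b p.2} = ∑ x ∈ s, #{i | a i = x} * #{j | b j = x} := by
  rw [card_eq_sum_card_fiberwise (f := fun p : ι × κ => a p.1) (t := s) fun p _ => hs p.1]
  refine sum_congr rfl fun x _ => ?_
  rw [← card_product]
  congr 1
  ext p
  simp only [mem_filter, mem_univ, true_and, mem_product]
  grind

open Finset in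
theorem Finset.two_mul_card_filter_eq_le {ι κ X : Type*} [Fintype ι] [Fintype κ]
    [DecidableEq X] (a : ι → X) (b : κ → X) :
    2 * #{p : ι × κ | a p.1 = b p.2} ≤
      #{p : ι × ι | a p.1 = a p.2} + #{p : κ × κ | b p.1 = b p.2} := by
  have ha : ∀ i, a i ∈ univ.image a ∪ univ.image b := by simp
  have hb : ∀ j, b j ∈ univ.image a ∪ univ.image b := by simp
  rw [card_filter_eq_eq_sum_card_mul_card a b ha, card_filter_eq_eq_sum_card_mul_card a a ha,
    card_filter_eq_eq_sum_card_mul_card b b hb, mul_sum, ← sum_add_distrib]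
  refine sum_le_sum fun x _ => ?_
  simpa only [sq, mul_assoc] using two_mul_le_add_sq #{i | a i = x} #{j | b j = x}

theorem Subgroup.exists_mem_inv_mul_mul_eq_iff {G : Type*} [Group G] (H : Subgroup G)
    (x y γ : G) :
    (∃ h ∈ H, x⁻¹ * h * y = γ) ↔
      Quotient.mk (QuotientGroup.rightRel H) (x * γ) = Quotient.mk _ y := by
  rw [Quotient.eq, QuotientGroup.rightRel_apply, ← H.inv_mem_iff]
  constructor
  · rintro ⟨h, hh, rfl⟩
    simpa [mul_assoc] using hh
  · intro h
    exact ⟨_, h, by group⟩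

/-- Let `G` be a group, `H ≤ G`, `n ≥ 1` and `(g_1, …, g_n) ∈ G^n`.  For each
`g ∈ G` let `E_g = {(i, j) : ∃ h ∈ H, g_i⁻¹ h g_j = g}`.  Then `|E_e| ≥ |E_g|`
for every `g ∈ G`, where `e = 1` is the identity of `G`. -/
theorem card_identity_edges_ge_card_edges
    {G : Type*} [Group G] (H : Subgroup G) {n : ℕ} (hn : 1 ≤ n)
    (g : Fin n → G) :
    ∀ γ : G,
      {p : Fin n × Fin n | ∃ h ∈ H, (g p.1)⁻¹ * h * g p.2 = γ}.ncard ≤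
        {p : Fin n × Fin n | ∃ h ∈ H, (g p.1)⁻¹ * h * g p.2 = (1 : G)}.ncard := by
  classical
  intro γ
  simp only [H.exists_mem_inv_mul_mul_eq_iff, mul_one, Set.ncard_eq_toFinset_card',
    Set.toFinset_ofPred]
  have h := Finset.two_mul_card_filter_eq_le
    (fun i => Quotient.mk (QuotientGroup.rightRel H) (g i * γ))
    (fun i => Quotient.mk (QuotientGroup.rightRel H) (g i))
  have translate (x y : G) : Quotient.mk (QuotientGroup.rightRel H) (x * γ) =
      Quotient.mk _ (y * γ) ↔ Quotient.mk (QuotientGroup.rightRel H) x = Quotient.mk _ y := by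
    simp [Quotient.eq, QuotientGroup.rightRel_apply, mul_assoc]
  simp only [translate] at h
  lia
end
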